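/- arXiv:2011.00974 — 3 statements merged into one kernel-verified Lean document; each statement's English description precedes it below -/
import Mathlib

section
/- Let n be a positive natural number with n ≡ 0 (mod 4), and let (r_i)_{i≥1} be nonnegative integers, all but finitely many equal to zero, such that ∑_{i≥1} r_i(2^i − 1) = n − α(n) − 1. Then ∑_{i≥1} r_i ≥ α(n) + 1, and equality holds if and only if the sequence (r_i)_{i≥1} is obtained from the binary digit sequence (ε_i(n))_{i≥1} by a single split. -/
/-- `alpha n` is the number of 1's in the binary expansion of `n`. -/
def alpha (n : ℕ) : ℕ := (Nat.digits 2 n).sum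

/-- `eps N i` is the coefficient of `2^i` in the binary expansion of `N`. -/
def eps (N i : ℕ) : ℕ := N / 2 ^ i % 2

/-- `IsSingleSplit s s'` means `s'` is obtained from `s` by choosing an index `i ≥ 2`
with `s i ≥ 1`, replacing `s (i-1)` by `s (i-1) + 2` and `s i` by `s i - 1`,
leaving all other entries unchanged. -/
def IsSingleSplit (s s' : ℕ → ℕ) : Prop :=
  ∃ i, 2 ≤ i ∧ 1 ≤ s i ∧ s' (i - 1) = s (i - 1) + 2 ∧ s' i = s i - 1 ∧
    ∀ j, j ≠ i - 1 → j ≠ i → s' j = s j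

theorem alpha_zero' : alpha 0 = 0 := by simp [alpha]

theorem alpha_even (m : ℕ) : alpha (2 * m) = alpha m := by
  rcases Nat.eq_zero_or_pos m with rfl | h
  · simp
  · unfold alpha
    rw [Nat.digits_def' (by norm_num) (by omega)]
    simp

theorem alpha_odd (m : ℕ) : alpha (2 * m + 1) = alpha m + 1 := by
  unfold alpha
  rw [Nat.digits_def' (by norm_num) (by omega)]
  have h1 : (2 * m + 1) % 2 = 1 := by omega
  have h2 : (2 * m + 1) / 2 = m := by omega
  rw [h1, h2, List.sum_cons]; omega

theorem alpha_bit (e m : ℕ) (he : e < 2) : alpha (e + 2 * m) = e + alpha m := by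
  interval_cases e
  · simpa using alpha_even m
  · have := alpha_odd m
    rw [Nat.add_comm 1 (2 * m)]; omega

theorem alpha_one' : alpha 1 = 1 := by
  have := alpha_odd 0
  simpa [alpha_zero'] using this

theorem alpha_succ_le (a : ℕ) : alpha (a + 1) ≤ alpha a + 1 := by
  induction a using Nat.strong_induction_on with
  | _ a ih =>
    rcases Nat.even_or_odd' a with ⟨k, rfl | rfl⟩
    · rw [alpha_odd, alpha_even]
    · have := ih k (by omega)
      rw [show 2 * k + 1 + 1 = 2 * (k + 1) by ring, alpha_odd, alpha_even]
      omega

theorem alpha_add_le (a : ℕ) : ∀ b, alpha (a + b) ≤ alpha a + alpha b := by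
  induction a using Nat.strong_induction_on with
  | _ a ih =>
    intro b
    rcases Nat.eq_zero_or_pos a with rfl | ha
    · simp
    rcases Nat.even_or_odd' a with ⟨k, rfl | rfl⟩ <;>
    rcases Nat.even_or_odd' b with ⟨l, rfl | rfl⟩
    · have := ih k (by omega) l
      rw [show 2 * k + 2 * l = 2 * (k + l) by ring]; simp only [alpha_even]; omega
    · have := ih k (by omega) l
      rw [show 2 * k + (2 * l + 1) = 2 * (k + l) + 1 by ring]
      simp only [alpha_even, alpha_odd]; omega
    · have := ih k (by omega) l
      rw [show 2 * k + 1 + 2 * l = 2 * (k + l) + 1 by ring]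
      simp only [alpha_even, alpha_odd]; omega
    · have := ih k (by omega) l
      have := alpha_succ_le (k + l)
      rw [show 2 * k + 1 + (2 * l + 1) = 2 * (k + l + 1) by ring]
      simp only [alpha_even, alpha_odd]; omega

theorem alpha_le_self' (a : ℕ) : alpha a ≤ a := by
  induction a with
  | zero => simp [alpha_zero']
  | succ a ih => have := alpha_succ_le a; omega

theorem sum_shift (r : ℕ → ℕ) (K : ℕ) :
    ∑ i ∈ Finset.range (K + 1), r i * 2 ^ i
      = r 0 + 2 * ∑ i ∈ Finset.range K, r (i + 1) * 2 ^ i := by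
  rw [Finset.sum_range_succ', Finset.mul_sum, add_comm]
  congr 1
  · simp
  · apply Finset.sum_congr rfl
    intro i _
    ring

theorem lemA (K : ℕ) : ∀ r : ℕ → ℕ,
    alpha (∑ i ∈ Finset.range K, r i * 2 ^ i) ≤ ∑ i ∈ Finset.range K, r i := by
  induction K with
  | zero => intro r; simp [alpha_zero']
  | succ K ih =>
    intro r
    have h := ih (fun i => r (i + 1))
    rw [sum_shift, Finset.sum_range_succ']
    have h1 := alpha_add_le (r 0) (2 * ∑ i ∈ Finset.range K, r (i + 1) * 2 ^ i)
    have h2 := alpha_le_self' (r 0)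
    rw [alpha_even] at h1
    omega

theorem eps_zero (e m : ℕ) (he : e < 2) : eps (e + 2 * m) 0 = e := by
  simp [eps]; omega

theorem eps_succ (e m j : ℕ) (he : e < 2) : eps (e + 2 * m) (j + 1) = eps m j := by
  unfold eps
  rw [pow_succ', ← Nat.div_div_eq_div_mul]
  congr 2
  omega

theorem lemC (K : ℕ) : ∀ r : ℕ → ℕ, (∀ i, K ≤ i → r i = 0) →
    ∑ i ∈ Finset.range K, r i = alpha (∑ i ∈ Finset.range K, r i * 2 ^ i) →
    ∀ j, r j = eps (∑ i ∈ Finset.range K, r i * 2 ^ i) j := by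
  induction K with
  | zero => intro r h0 _ j; simp [h0, eps]
  | succ K ih =>
    intro r h0 hs j
    have hA := lemA K (fun i => r (i + 1))
    have hI := ih (fun i => r (i + 1)) (fun i hi => h0 _ (by omega))
    rw [sum_shift] at hs ⊢
    rw [Finset.sum_range_succ'] at hs
    generalize ∑ i ∈ Finset.range K, r (i + 1) * 2 ^ i = M at *
    generalize ∑ i ∈ Finset.range K, r (i + 1) = S at *
    have h1 : r 0 + 2 * M = r 0 % 2 + 2 * (M + r 0 / 2) := by omega
    have he : r 0 % 2 < 2 := by omega
    rw [h1, alpha_bit _ _ he] at hs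
    have h2 := alpha_add_le M (r 0 / 2)
    have h3 := alpha_le_self' (r 0 / 2)
    have hc : r 0 / 2 = 0 := by omega
    rw [hc] at hs h1
    rw [h1]
    cases j with
    | zero => rw [eps_zero _ _ he]; omega
    | succ j => rw [eps_succ _ _ _ he]; exact hI (by simp at hs; omega) j

theorem lemB (K : ℕ) : ∀ r : ℕ → ℕ, (∀ i, K ≤ i → r i = 0) →
    ∑ i ∈ Finset.range K, r i = alpha (∑ i ∈ Finset.range K, r i * 2 ^ i) + 1 →
    ∃ i, eps (∑ i ∈ Finset.range K, r i * 2 ^ i) (i + 1) = 1 ∧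
      r i = eps (∑ i ∈ Finset.range K, r i * 2 ^ i) i + 2 ∧ r (i + 1) = 0 ∧
      ∀ j, j ≠ i → j ≠ i + 1 → r j = eps (∑ i ∈ Finset.range K, r i * 2 ^ i) j := by
  induction K with
  | zero => intro r h0 h; simp at h
  | succ K ih =>
    intro r h0 hs
    have hA := lemA K (fun i => r (i + 1))
    have hI := ih (fun i => r (i + 1)) (fun i hi => h0 _ (by omega))
    have hC := lemC K (fun i => r (i + 1)) (fun i hi => h0 _ (by omega))
    rw [sum_shift] at hs ⊢
    rw [Finset.sum_range_succ'] at hs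
    generalize ∑ i ∈ Finset.range K, r (i + 1) * 2 ^ i = M at *
    generalize ∑ i ∈ Finset.range K, r (i + 1) = S at *
    have h1 : r 0 + 2 * M = r 0 % 2 + 2 * (M + r 0 / 2) := by omega
    have he : r 0 % 2 < 2 := by omega
    rw [h1, alpha_bit _ _ he] at hs
    have h2 := alpha_add_le M (r 0 / 2)
    have h3 := alpha_le_self' (r 0 / 2)
    have hc : r 0 / 2 = 0 ∨ r 0 / 2 = 1 := by omega
    rcases hc with hc | hc
    · rw [hc] at hs h1
      rw [h1]
      obtain ⟨i, a, b, c, d⟩ := hI (by simp at hs; omega)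
      refine ⟨i + 1, ?_, ?_, c, ?_⟩
      · rw [eps_succ _ _ _ he]; exact a
      · rw [eps_succ _ _ _ he]; exact b
      · intro j hj hj'
        cases j with
        | zero => rw [eps_zero _ _ he]; omega
        | succ j => rw [eps_succ _ _ _ he]; exact d j (by omega) (by omega)
    · rw [hc] at hs h1 h2
      rw [h1]
      rw [alpha_one'] at h2
      have hC' := hC (by omega)
      have hM : alpha (M + 1) = alpha M + 1 := by omega
      rcases Nat.even_or_odd' M with ⟨k, rfl | rfl⟩
      · have e1 : 2 * k + 1 = 1 + 2 * k := by ring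
        have e0 : 2 * k = 0 + 2 * k := by ring
        refine ⟨0, ?_, ?_, ?_, ?_⟩
        · rw [eps_succ _ _ _ he, e1, eps_zero _ _ (by omega)]
        · rw [eps_zero _ _ he]; omega
        · rw [hC', e0, eps_zero _ _ (by omega)]
        · intro j hj hj'
          obtain ⟨j, rfl⟩ : ∃ t, j = t + 1 + 1 := ⟨j - 2, by omega⟩
          rw [eps_succ _ _ _ he, hC' (j + 1), e1, eps_succ _ _ _ (by omega)]
          nth_rewrite 1 [e0]
          rw [eps_succ _ _ _ (by omega)]
      · have := alpha_succ_le k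
        rw [show 2 * k + 1 + 1 = 2 * (k + 1) by ring, alpha_odd, alpha_even] at hM
        omega

theorem sum_eps (K : ℕ) : ∀ n, n < 2 ^ K → ∑ i ∈ Finset.range K, eps n i = alpha n := by
  induction K with
  | zero => intro n h; have : n = 0 := by simpa using h
            subst this; simp [alpha_zero']
  | succ K ih =>
    intro n h
    rw [pow_succ] at h
    have e : n = n % 2 + 2 * (n / 2) := by omega
    have he : n % 2 < 2 := by omega
    have := ih (n / 2) (by omega)
    generalize n / 2 = m at *
    generalize n % 2 = b at *
    subst e
    rw [Finset.sum_range_succ', eps_zero _ _ he, alpha_bit _ _ he]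
    simp only [eps_succ _ _ _ he]
    omega

theorem stmt0 (n : ℕ) (hn : 0 < n) (h4 : n % 4 = 0)
    (r : ℕ → ℕ) (hr0 : r 0 = 0) (hfin : (Function.support r).Finite)
    (hsum : ∑ᶠ i, r i * (2 ^ i - 1) = n - alpha n - 1) :
    alpha n + 1 ≤ ∑ᶠ i, r i ∧
      ((∑ᶠ i, r i) = alpha n + 1 ↔ IsSingleSplit (eps n) r) := by
  obtain ⟨B, hB⟩ := hfin.bddAbove
  obtain ⟨K, hKn, hK⟩ : ∃ K, n < K ∧ ∀ i, K ≤ i → r i = 0 := by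
    refine ⟨n + B + 1, by omega, fun i hi => ?_⟩
    by_contra h
    have := hB (show i ∈ Function.support r from h)
    omega
  have hs1 : ∑ᶠ i, r i = ∑ i ∈ Finset.range K, r i := by
    apply finsum_eq_sum_of_support_subset
    intro i hi
    simp only [Finset.coe_range, Set.mem_Iio]
    by_contra h
    exact hi (hK i (by omega))
  have hs2 : ∑ᶠ i, r i * (2 ^ i - 1) = ∑ i ∈ Finset.range K, r i * (2 ^ i - 1) := by
    apply finsum_eq_sum_of_support_subset
    intro i hi
    simp only [Finset.coe_range, Set.mem_Iio]
    by_contra h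
    exact hi (by simp [hK i (by omega)])
  have hs3 : ∑ i ∈ Finset.range K, r i * 2 ^ i
      = ∑ i ∈ Finset.range K, r i * (2 ^ i - 1) + ∑ i ∈ Finset.range K, r i := by
    rw [← Finset.sum_add_distrib]
    apply Finset.sum_congr rfl
    intro i _
    have : 2 ^ i = (2 ^ i - 1) + 1 := by have := Nat.one_le_two_pow (n := i); omega
    nth_rewrite 1 [this]
    ring
  have hev : ∃ t, ∑ i ∈ Finset.range K, r i * 2 ^ i = 2 * t := by
    obtain ⟨L, rfl⟩ : ∃ L, K = L + 1 := ⟨K - 1, by omega⟩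
    exact ⟨_, by rw [sum_shift, hr0, zero_add]⟩
  have hA := lemA K r
  have hBB := lemB K r hK
  rw [hs1]
  rw [hs2] at hsum
  rw [hsum] at hs3
  obtain ⟨m, rfl⟩ : ∃ m, n = 2 * (2 * m) := ⟨n / 4, by omega⟩
  have hαn : alpha (2 * (2 * m)) = alpha m := by rw [alpha_even, alpha_even]
  have hαm := alpha_le_self' m
  have hsE := sum_eps K (2 * (2 * m)) (lt_trans hKn Nat.lt_two_pow_self)
  rw [hs3] at hA hBB hev
  refine ⟨?_, ?_, ?_⟩
  · clear hBB
    generalize ∑ i ∈ Finset.range K, r i = R at *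
    by_contra hlt
    obtain ⟨t, ht⟩ := hev
    obtain ⟨k, hk⟩ : ∃ k, 2 * (2 * m) = 2 * t + 2 * k := ⟨2 * m - t, by omega⟩
    rw [ht] at hA
    have h1 := alpha_add_le (2 * t) (2 * k)
    rw [← hk, alpha_even k] at h1
    have h2 := alpha_le_self' k
    have hk1 : k = 1 := by omega
    obtain ⟨p, rfl⟩ : ∃ p, m = p + 1 := ⟨m - 1, by omega⟩
    have h3 := alpha_succ_le p
    have : 2 * t = 2 * (2 * p + 1) := by omega
    rw [this, alpha_even, alpha_odd] at hA
    omega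
  · intro hR
    have e : 2 * (2 * m) - alpha (2 * (2 * m)) - 1 + ∑ i ∈ Finset.range K, r i
        = 2 * (2 * m) := by clear hBB hev; omega
    rw [e] at hBB
    obtain ⟨i, a, b, c, d⟩ := hBB hR
    have hi : i ≠ 0 := by rintro rfl; omega
    refine ⟨i + 1, by omega, by omega, ?_, by omega, ?_⟩
    · simpa using b
    · intro j hj hj'
      exact d j (by simpa using hj) hj'
  · rintro ⟨i, hi2, h1, ha, hb, hc⟩
    have hiK : i < K := by
      by_contra h
      have : 2 * (2 * m) < 2 ^ i := lt_of_lt_of_le (lt_trans hKn Nat.lt_two_pow_self)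
        (Nat.pow_le_pow_right (by norm_num) (by omega))
      simp [eps, Nat.div_eq_of_lt this] at h1
    have hp : ∑ j ∈ Finset.range K, (r j + if i = j then 1 else 0)
        = ∑ j ∈ Finset.range K, (eps (2 * (2 * m)) j + if i - 1 = j then 2 else 0) := by
      apply Finset.sum_congr rfl
      intro j _
      by_cases hj : j = i
      · subst hj
        rw [if_pos rfl, if_neg (by omega)]; omega
      · by_cases hj' : j = i - 1
        · subst hj'
          rw [if_pos rfl, if_neg (by omega)]; omega
        · rw [if_neg (by omega), if_neg (by omega), hc j hj' hj]
    rw [Finset.sum_add_distrib, Finset.sum_add_distrib, Finset.sum_ite_eq, Finset.sum_ite_eq,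
      if_pos (by simpa using hiK), if_pos (by simp; omega), hsE] at hp
    omega
end

section
/- Let c₁, c₂ be nonnegative integers and let (b_j)_{j≥3} be integers with b_j ≥ −1 for all j ≥ 3 and all but finitely many b_j equal to zero. If 8c₁ + 8c₂ + ∑_{j≥3} 2^j b_j ≤ 0 and 0 ≤ 4c₁ + 6c₂ + ∑_{j≥3} (2^j − 1) b_j, then c₁ = 0, c₂ = 0, and b_j = 0 for all j ≥ 3. -/
theorem aux (n : ℕ) : ∀ (a : ℕ → ℤ), (∀ i, -1 ≤ a i) →
    (∑ i ∈ Finset.range n, 2 ^ i * a i) ≤ 0 →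
    (∑ i ∈ Finset.range n, 2 ^ i * a i) ≤ ∑ i ∈ Finset.range n, a i ∧
    ((∑ i ∈ Finset.range n, 2 ^ i * a i) = 0 → (∑ i ∈ Finset.range n, a i) = 0 →
      ∀ i < n, a i = 0) := by
  induction n with
  | zero => intro a _ _; simp
  | succ n ih =>
    intro a ha hx
    have e : (∑ i ∈ Finset.range (n+1), 2 ^ i * a i) =
        2 * (∑ i ∈ Finset.range n, 2 ^ i * a (i+1)) + a 0 := by
      rw [Finset.sum_range_succ', Finset.mul_sum]
      congr 1
      · apply Finset.sum_congr rfl; intros; ring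
      · simp
    rw [e] at hx ⊢
    rw [Finset.sum_range_succ' a]
    have h0 := ha 0
    obtain ⟨h1, h2⟩ := ih (fun i => a (i+1)) (fun i => ha _) (by omega)
    refine ⟨by omega, fun p q => ?_⟩
    have h3 := h2 (by omega) (by omega)
    intro i hi
    rcases i with _ | i
    · omega
    · exact h3 i (by omega)

theorem aux2 (b : ℕ → ℤ) (n : ℕ) (hn : ∀ j, n ≤ j → b j = 0) (w : ℕ → ℤ) :
    ∑ᶠ j ∈ Set.Ici 3, w j * b j = ∑ i ∈ Finset.range n, w (3 + i) * b (3 + i) := by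
  rw [finsum_mem_eq_sum_of_inter_support_eq (t := Finset.Ico 3 (n+3)),
    Finset.sum_Ico_eq_sum_range]
  · simp
  · ext j
    simp only [Set.mem_inter_iff, Set.mem_Ici, Function.mem_support, Finset.coe_Ico, Set.mem_Ico]
    constructor
    · rintro ⟨h, h'⟩
      refine ⟨⟨h, ?_⟩, h'⟩
      by_contra hc
      exact h' (by rw [hn j (by omega), mul_zero])
    · rintro ⟨⟨h, _⟩, h'⟩
      exact ⟨h, h'⟩

theorem stmt4 (c₁ c₂ : ℕ) (b : ℕ → ℤ)
    (hb : ∀ j, 3 ≤ j → -1 ≤ b j) (hfin : (Function.support b).Finite)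
    (h1 : 8 * (c₁ : ℤ) + 8 * (c₂ : ℤ) + ∑ᶠ j ∈ Set.Ici 3, 2 ^ j * b j ≤ 0)
    (h2 : 0 ≤ 4 * (c₁ : ℤ) + 6 * (c₂ : ℤ) + ∑ᶠ j ∈ Set.Ici 3, (2 ^ j - 1) * b j) :
    c₁ = 0 ∧ c₂ = 0 ∧ ∀ j, 3 ≤ j → b j = 0 := by
  obtain ⟨m, hm⟩ := hfin.bddAbove
  have hn : ∀ j, m + 1 ≤ j → b j = 0 := by
    intro j hj
    by_contra hc
    have := hm (show j ∈ Function.support b from hc)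
    omega
  rw [aux2 b (m+1) hn (fun j => 2 ^ j)] at h1
  rw [aux2 b (m+1) hn (fun j => 2 ^ j - 1)] at h2
  have e : ∑ i ∈ Finset.range (m+1), (2:ℤ) ^ (3 + i) * b (3 + i) =
      8 * ∑ i ∈ Finset.range (m+1), (2:ℤ) ^ i * b (3 + i) := by
    rw [Finset.mul_sum]
    apply Finset.sum_congr rfl; intros; ring
  simp only [sub_mul, one_mul, Finset.sum_sub_distrib] at h1 h2
  rw [e] at h1 h2
  obtain ⟨h3, h4⟩ := aux (m+1) (fun i => b (3 + i)) (fun i => hb _ (by omega)) (by omega)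
  have h5 := h4 (by omega) (by omega)
  refine ⟨by omega, by omega, fun j hj => ?_⟩
  by_cases hc : m + 1 ≤ j
  · exact hn j hc
  · have := h5 (j - 3) (by omega)
    rwa [show 3 + (j - 3) = j by omega] at this
end

section
/- Let S be a finite set of positive natural numbers and let T be a finite multiset of natural numbers no element of which belongs to S. If ∑_{t∈T} 2^t ≤ ∑_{j∈S} 2^j and ∑_{j∈S} (2^j − 1) ≤ ∑_{t∈T} (2^t − 1), then S is empty and T is empty. -/
theorem aux_unique (S : Finset ℕ) : ∀ (n : ℕ) (T : Multiset ℕ), T.card = n → T.card ≤ S.card →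
    (T.map fun t => 2 ^ t).sum = ∑ j ∈ S, 2 ^ j → T = S.val := by
  intro n
  induction n with
  | zero =>
    intro T hT _ h
    have h0 : T = 0 := Multiset.card_eq_zero.mp hT
    subst h0
    have : S = ∅ := by
      by_contra hne
      have : 0 < ∑ j ∈ S, 2 ^ j :=
        Finset.sum_pos (fun i _ => by positivity) (Finset.nonempty_iff_ne_empty.mpr hne)
      simp at h
      simp_all
    simp [this]
  | succ n ih =>
    intro T hT hle h
    by_cases hd : T.Nodup
    · have := Finset.geomSum_injective (n := 2) le_rfl (a₁ := ⟨T, hd⟩) (a₂ := S) h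
      rw [← this]
    · rw [Multiset.nodup_iff_le] at hd
      push Not at hd
      obtain ⟨a, ha⟩ := hd
      obtain ⟨U, rfl⟩ := Multiset.le_iff_exists_add.mp ha
      simp at hT hle h
      have := ih ((a + 1) ::ₘ U) (by simp; omega) (by simp; omega) (by
        simp only [Multiset.map_cons, Multiset.sum_cons, ← h]; ring)
      have h3 := congrArg Multiset.card this
      simp at h3
      omega

theorem aux_sum (T : Multiset ℕ) :
    (T.map fun t => 2 ^ t - 1).sum + T.card = (T.map fun t => 2 ^ t).sum := by
  induction T using Multiset.induction_on with
  | empty => simp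
  | cons a T ih =>
    have : 1 ≤ 2 ^ a := Nat.one_le_two_pow
    simp only [Multiset.map_cons, Multiset.sum_cons, Multiset.card_cons]
    omega

theorem stmt6 (S : Finset ℕ) (hS : ∀ j ∈ S, 0 < j)
    (T : Multiset ℕ) (hTS : ∀ t ∈ T, t ∉ S)
    (h1 : (T.map fun t => 2 ^ t).sum ≤ ∑ j ∈ S, 2 ^ j)
    (h2 : ∑ j ∈ S, (2 ^ j - 1) ≤ (T.map fun t => 2 ^ t - 1).sum) :
    S = ∅ ∧ T = 0 := by
  obtain ⟨d, hd⟩ := Nat.exists_eq_add_of_le h1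
  have hT := aux_sum T
  have hS' : ∑ j ∈ S, (2 ^ j - 1) + S.card = ∑ j ∈ S, 2 ^ j := aux_sum S.val
  have key := aux_unique S _ (T + Multiset.replicate d 0) rfl
    (by simp only [Multiset.card_add, Multiset.card_replicate]; omega) (by simp [hd])
  have hE : S = ∅ := by
    rw [Finset.eq_empty_iff_forall_notMem]
    intro j hj
    have hj' : j ∈ T + Multiset.replicate d 0 := by rw [key]; exact hj
    rcases Multiset.mem_add.mp hj' with h | h
    · exact hTS j h hj
    · have := Multiset.eq_of_mem_replicate h
      have := hS j hj
      omega
  refine ⟨hE, ?_⟩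
  subst hE
  have h3 := congrArg Multiset.card key
  simp at h3
  exact h3.1
end
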